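/- Let $k$ be a field, $g\ge 3$, and let $A$ be the quotient of $k[u_0,\dots,u_{g-1},v_0,\dots,v_{g-3}]$ (with $\deg u_i=1$, $\deg v_j=2$) by the ideal generated by $u_iu_j-u_ku_l$, $u_iv_j-u_kv_l$ (for $i+j=k+l$) and $v_iv_j$. Then the Hilbert series of $A$ is $1+gt+(g-2)\sum_{n\ge 2}(2n-1)t^n$, i.e., $\dim_k A_0=1$, $\dim_k A_1=g$, and $\dim_k A_n=(2n-1)(g-2)$ for $n\ge 2$. -/

import Mathlib

open MvPolynomial

noncomputable section

/-- Variables `u₀,…,u_{g-1}` (weight 1) and `v₀,…,v_{g-3}` (weight 2). -/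
abbrev RibVar (g : ℕ) := Fin g ⊕ Fin (g - 2)

/-- the weights: `deg uᵢ = 1`, `deg vⱼ = 2`. -/
def ribWeight (g : ℕ) : RibVar g → ℕ := Sum.elim (fun _ => 1) (fun _ => 2)

abbrev Ugen (k : Type*) [Field k] {g : ℕ} (i : Fin g) : MvPolynomial (RibVar g) k :=
  X (Sum.inl i)
abbrev Vgen (k : Type*) [Field k] {g : ℕ} (j : Fin (g - 2)) : MvPolynomial (RibVar g) k :=
  X (Sum.inr j)

/-- The defining relations: `uᵢuⱼ - u_k u_l`, `uᵢvⱼ - u_k v_l` for `i+j = k+l`, `vᵢvⱼ`. -/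
def ribRels (k : Type*) [Field k] (g : ℕ) : Set (MvPolynomial (RibVar g) k) :=
  {f | ∃ i j l m : Fin g, (i : ℕ) + (j : ℕ) = (l : ℕ) + (m : ℕ) ∧
        f = Ugen k i * Ugen k j - Ugen k l * Ugen k m} ∪
  {f | ∃ i l : Fin g, ∃ j m : Fin (g - 2), (i : ℕ) + (j : ℕ) = (l : ℕ) + (m : ℕ) ∧
        f = Ugen k i * Vgen k j - Ugen k l * Vgen k m} ∪
  {f | ∃ j m : Fin (g - 2), f = Vgen k j * Vgen k m}

/-- The homogeneous coordinate ring `A` of the hyperelliptic ribbon. -/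
abbrev RibAlg (k : Type*) [Field k] (g : ℕ) :=
  MvPolynomial (RibVar g) k ⧸ Ideal.span (ribRels k g)

/-- The degree-`n` graded piece `Aₙ` for the weighted grading (`deg uᵢ = 1`, `deg vⱼ = 2`):
the image in `A` of the weighted-homogeneous polynomials of weighted degree `n`. -/
def gradedPiece (k : Type*) [Field k] (g n : ℕ) : Submodule k (RibAlg k g) :=
  Submodule.map (Ideal.Quotient.mkₐ k (Ideal.span (ribRels k g))).toLinearMap
    (MvPolynomial.weightedHomogeneousSubmodule k (ribWeight g) n)

/-- Canonical product of `n` of the `u`s with index sum `s`. -/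
def canU {A : Type*} [CommRing A] (u : ℕ → A) (c : ℕ) : ℕ → ℕ → A
  | 0, _ => 1
  | n + 1, s => u (min s c) * canU u c n (s - min s c)

/-- Canonical product of one `v` and `n` of the `u`s with index sum `s`. -/
def canV {A : Type*} [CommRing A] (u v : ℕ → A) (c n s : ℕ) : A :=
  v (min s (c - 2)) * canU u c n (s - min s (c - 2))

theorem canU_mul {A : Type*} [CommRing A] (u : ℕ → A) (c : ℕ)
    (huu : ∀ i j l m, i ≤ c → j ≤ c → l ≤ c → m ≤ c → i + j = l + m → u i * u j = u l * u m)
    (n : ℕ) : ∀ i s, i ≤ c → s ≤ n * c → u i * canU u c n s = canU u c (n + 1) (s + i) := by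
  induction n with
  | zero =>
    intro i s hi hs
    have : s = 0 := by simpa using hs
    subst this
    simp [canU, hi]
  | succ n ih =>
    intro i s hi hs
    rw [add_mul, one_mul] at hs
    rw [show canU u c (n + 1) s = u (min s c) * canU u c n (s - min s c) from rfl,
      show canU u c (n + 1 + 1) (s + i)
        = u (min (s + i) c) * canU u c (n + 1) (s + i - min (s + i) c) from rfl,
      ← mul_assoc, huu i (min s c) (min (s + i) c) (i + min s c - min (s + i) c) hi
        (by omega) (by omega) (by omega) (by omega), mul_assoc, ih _ _ (by omega) (by omega)]
    congr 2
    omega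

theorem canV_v_mul {A : Type*} [CommRing A] (u v : ℕ → A) (c : ℕ) (hc : 2 ≤ c)
    (huu : ∀ i j l m, i ≤ c → j ≤ c → l ≤ c → m ≤ c → i + j = l + m → u i * u j = u l * u m)
    (huv : ∀ i j l m, i ≤ c → j + 2 ≤ c → l ≤ c → m + 2 ≤ c → i + j = l + m →
      u i * v j = u l * v m)
    (n j s : ℕ) (hj : j + 2 ≤ c) (hs : s ≤ n * c) :
    v j * canU u c n s = canV u v c n (s + j) := by
  unfold canV
  cases n with
  | zero =>
    have : s = 0 := by simpa using hs
    subst this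
    have : min (0 + j) (c - 2) = j := by omega
    rw [this]; simp [canU]
  | succ n =>
    rw [add_mul, one_mul] at hs
    rw [show canU u c (n + 1) s = u (min s c) * canU u c n (s - min s c) from rfl,
      ← mul_assoc, mul_comm (v j), huv (min s c) j (min s c + j - min (s + j) (c - 2))
        (min (s + j) (c - 2)) (by omega) hj (by omega) (by omega) (by omega),
      mul_comm (u _), mul_assoc, canU_mul u c huu n _ _ (by omega) (by omega)]
    congr 2
    omega

theorem canV_u_mul {A : Type*} [CommRing A] (u v : ℕ → A) (c : ℕ) (hc : 2 ≤ c)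
    (huu : ∀ i j l m, i ≤ c → j ≤ c → l ≤ c → m ≤ c → i + j = l + m → u i * u j = u l * u m)
    (huv : ∀ i j l m, i ≤ c → j + 2 ≤ c → l ≤ c → m + 2 ≤ c → i + j = l + m →
      u i * v j = u l * v m)
    (n i s : ℕ) (hi : i ≤ c) (hs : s + 2 ≤ n * c + c) :
    u i * canV u v c n s = canV u v c (n + 1) (s + i) := by
  have h1 : (n + 1) * c = n * c + c := by ring
  have h2 : u i * canV u v c n s
      = v (min s (c - 2)) * (u i * canU u c n (s - min s (c - 2))) := by
    unfold canV; ring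
  rw [h2, canU_mul u c huu n i _ hi (by omega),
    canV_v_mul u v c hc huu huv (n + 1) _ _ (by omega) (by omega)]
  congr 1
  omega

/-- The `u`s in the quotient, indexed by natural numbers. -/
def uA (k : Type*) [Field k] (c : ℕ) (i : ℕ) : RibAlg k (c + 1) :=
  if h : i < c + 1 then Ideal.Quotient.mkₐ k _ (Ugen k ⟨i, h⟩) else 0

/-- The `v`s in the quotient, indexed by natural numbers. -/
def vA (k : Type*) [Field k] (c : ℕ) (i : ℕ) : RibAlg k (c + 1) :=
  if h : i < c + 1 - 2 then Ideal.Quotient.mkₐ k _ (Vgen k ⟨i, h⟩) else 0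

theorem uA_uA (k : Type*) [Field k] (c : ℕ) (i j l m : ℕ) (hi : i ≤ c) (hj : j ≤ c)
    (hl : l ≤ c) (hm : m ≤ c) (h : i + j = l + m) :
    uA k c i * uA k c j = uA k c l * uA k c m := by
  unfold uA
  rw [dif_pos (by omega), dif_pos (by omega), dif_pos (by omega), dif_pos (by omega),
    ← map_mul, ← map_mul]
  apply Ideal.Quotient.eq.2
  apply Ideal.subset_span
  exact Or.inl (Or.inl ⟨_, _, _, _, h, rfl⟩)

theorem uA_vA (k : Type*) [Field k] (c : ℕ) (i j l m : ℕ) (hi : i ≤ c) (hj : j + 2 ≤ c)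
    (hl : l ≤ c) (hm : m + 2 ≤ c) (h : i + j = l + m) :
    uA k c i * vA k c j = uA k c l * vA k c m := by
  unfold uA vA
  rw [dif_pos (by omega), dif_pos (by omega), dif_pos (by omega), dif_pos (by omega),
    ← map_mul, ← map_mul]
  apply Ideal.Quotient.eq.2
  apply Ideal.subset_span
  exact Or.inl (Or.inr ⟨_, _, _, _, h, rfl⟩)

theorem vA_vA (k : Type*) [Field k] (c : ℕ) (i j : ℕ) : vA k c i * vA k c j = 0 := by
  unfold vA
  split_ifs
  · rw [← map_mul]
    apply Ideal.Quotient.eq_zero_iff_mem.2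
    apply Ideal.subset_span
    exact Or.inr ⟨_, _, rfl⟩
  all_goals simp

theorem mk_monomial_cases (k : Type*) [Field k] (c : ℕ) (hc : 2 ≤ c)
    (d : Multiset (RibVar (c + 1))) :
    let x := Ideal.Quotient.mkₐ k (Ideal.span (ribRels k (c + 1)))
      (d.map (fun i => (X i : MvPolynomial (RibVar (c + 1)) k))).prod
    let n := (d.map (ribWeight (c + 1))).sum
    x = 0 ∨ (∃ s ≤ n * c, x = canU (uA k c) c n s) ∨
      (∃ m s, m + 2 = n ∧ s + 2 ≤ m * c + c ∧ x = canV (uA k c) (vA k c) c m s) := by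
  induction d using Multiset.induction with
  | empty =>
    right; left
    exact ⟨0, by simp, by simp [canU]⟩
  | cons a d ih =>
    intro x n
    dsimp only at ih
    have hx : x = Ideal.Quotient.mkₐ k _ (X a) * Ideal.Quotient.mkₐ k
        (Ideal.span (ribRels k (c + 1)))
        (d.map (fun i => (X i : MvPolynomial (RibVar (c + 1)) k))).prod := by
      rw [← map_mul]; simp [x]
    have hn : n = ribWeight (c + 1) a + (d.map (ribWeight (c + 1))).sum := by simp [n]
    clear_value x n
    generalize Ideal.Quotient.mkₐ k (Ideal.span (ribRels k (c + 1)))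
        (d.map (fun i => (X i : MvPolynomial (RibVar (c + 1)) k))).prod = y at *
    generalize (d.map (ribWeight (c + 1))).sum = n' at *
    rcases a with i | j
    · have hu : Ideal.Quotient.mkₐ k (Ideal.span (ribRels k (c + 1))) (X (Sum.inl i))
          = uA k c i := by simp only [uA, dif_pos i.2]
      have hi : (i : ℕ) ≤ c := by omega
      rw [hu] at hx
      have hn2 : n = n' + 1 := by simp [hn, ribWeight, add_comm]
      have h1 : (n' + 1) * c = n' * c + c := by ring
      rcases ih with h | ⟨s, hs, h⟩ | ⟨m, s, hm, hs, h⟩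
      · left; simp [hx, h]
      · right; left
        refine ⟨s + i, ?_, ?_⟩
        · rw [hn2]; omega
        · rw [hx, h, canU_mul _ c (uA_uA k c) n' i s hi hs, hn2]
      · right; right
        refine ⟨m + 1, s + i, by omega, ?_, ?_⟩
        · have : (m + 1) * c = m * c + c := by ring
          omega
        · rw [hx, h, canV_u_mul _ _ c hc (uA_uA k c) (uA_vA k c) m i s hi hs]
    · have hj2 : (j : ℕ) < c + 1 - 2 := j.2
      have hv : Ideal.Quotient.mkₐ k (Ideal.span (ribRels k (c + 1))) (X (Sum.inr j))
          = vA k c j := by simp only [vA, dif_pos hj2]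
      have hj : (j : ℕ) + 2 ≤ c := by omega
      rw [hv] at hx
      have hn2 : n = n' + 2 := by simp [hn, ribWeight, add_comm]
      rcases ih with h | ⟨s, hs, h⟩ | ⟨m, s, hm, hs, h⟩
      · left; simp [hx, h]
      · right; right
        refine ⟨n', s + j, by omega, by omega, ?_⟩
        rw [hx, h, canV_v_mul _ _ c hc (uA_uA k c) (uA_vA k c) n' j s hj hs]
      · left
        rw [hx, h, canV, ← mul_assoc, vA_vA, zero_mul]

/-- The basis family in degree `n`. -/
def ribFam (k : Type*) [Field k] (c n : ℕ) :
    Fin (n * c + 1) ⊕ Fin (n * c - (c + 1)) → RibAlg k (c + 1) :=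
  Sum.elim (fun s => canU (uA k c) c n s) (fun s => canV (uA k c) (vA k c) c (n - 2) s)

theorem monomial_eq_multiset (k : Type*) [Field k] {σ : Type*} (d : σ →₀ ℕ) :
    (monomial d 1 : MvPolynomial σ k) = ((Finsupp.toMultiset d).map X).prod := by
  induction d using Finsupp.induction_linear with
  | zero => simp
  | add f g hf hg => rw [map_add, Multiset.map_add, Multiset.prod_add, ← hf, ← hg]; simp
  | single a b => simp [X_pow_eq_monomial, Multiset.map_nsmul, Multiset.prod_nsmul]

theorem weight_eq_multiset {σ : Type*} (w : σ → ℕ) (d : σ →₀ ℕ) :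
    Finsupp.weight w d = ((Finsupp.toMultiset d).map w).sum := by
  induction d using Finsupp.induction_linear with
  | zero => simp
  | add f g hf hg => rw [map_add, map_add, Multiset.map_add, Multiset.sum_add, ← hf, ← hg]
  | single a b => simp [Finsupp.weight_apply, Multiset.map_nsmul, Multiset.sum_nsmul]

theorem uA_mem (k : Type*) [Field k] (c i : ℕ) : uA k c i ∈ gradedPiece k (c + 1) 1 := by
  unfold uA
  split_ifs with h
  · exact ⟨_, isWeightedHomogeneous_X k (ribWeight (c + 1)) (Sum.inl ⟨i, h⟩), rfl⟩
  · exact Submodule.zero_mem _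

theorem vA_mem (k : Type*) [Field k] (c i : ℕ) : vA k c i ∈ gradedPiece k (c + 1) 2 := by
  unfold vA
  split_ifs with h
  · exact ⟨_, isWeightedHomogeneous_X k (ribWeight (c + 1)) (Sum.inr ⟨i, h⟩), rfl⟩
  · exact Submodule.zero_mem _

theorem piece_mul (k : Type*) [Field k] (g m n : ℕ) (x y : RibAlg k g)
    (hx : x ∈ gradedPiece k g m) (hy : y ∈ gradedPiece k g n) :
    x * y ∈ gradedPiece k g (m + n) := by
  obtain ⟨p, hp, rfl⟩ := hx
  obtain ⟨q, hq, rfl⟩ := hy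
  exact ⟨p * q, IsWeightedHomogeneous.mul hp hq, by simp⟩

theorem canU_mem (k : Type*) [Field k] (c n : ℕ) :
    ∀ s, canU (uA k c) c n s ∈ gradedPiece k (c + 1) n := by
  induction n with
  | zero => intro s; exact ⟨1, isWeightedHomogeneous_one k _, by simp [canU]⟩
  | succ n ih =>
    intro s
    have := piece_mul k (c + 1) 1 n _ _ (uA_mem k c (min s c)) (ih (s - min s c))
    rw [add_comm 1 n] at this
    exact this

theorem span_ribFam (k : Type*) [Field k] (c n : ℕ) (hc : 2 ≤ c) :
    Submodule.span k (Set.range (ribFam k c n)) = gradedPiece k (c + 1) n := by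
  apply le_antisymm
  · rw [Submodule.span_le]
    rintro _ ⟨s | s, rfl⟩
    · exact canU_mem k c n s
    · have hs := s.2
      have hn : 2 ≤ n := by
        by_contra h
        have : n = 0 ∨ n = 1 := by omega
        rcases this with h | h <;> subst h <;> simp at hs
      obtain ⟨m, rfl⟩ := Nat.exists_eq_add_of_le hn
      have := piece_mul k (c + 1) 2 m _ _ (vA_mem k c (min (s : ℕ) (c - 2)))
        (canU_mem k c m ((s : ℕ) - min (s : ℕ) (c - 2)))
      simpa [ribFam, canV] using this
  · rintro _ ⟨p, hp, rfl⟩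
    rw [p.as_sum, map_sum]
    apply Submodule.sum_mem
    intro d hd
    have hw : Finsupp.weight (ribWeight (c + 1)) d = n := hp (mem_support_iff.1 hd)
    have h1 : monomial d (coeff d p) = coeff d p • (monomial d 1 : MvPolynomial _ k) := by
      simp [smul_monomial]
    rw [h1, map_smul]
    apply Submodule.smul_mem
    have hw2 : ((Finsupp.toMultiset d).map (ribWeight (c + 1))).sum = n := by
      rw [← hw, weight_eq_multiset]
    have key := mk_monomial_cases k c hc (Finsupp.toMultiset d)
    dsimp only at key
    rw [← monomial_eq_multiset, hw2] at key
    rw [AlgHom.toLinearMap_apply]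
    rcases key with h | ⟨s, hs, h⟩ | ⟨m, s, hm, hs, h⟩
    · rw [h]; exact Submodule.zero_mem _
    · rw [h]
      exact Submodule.subset_span ⟨Sum.inl ⟨s, by omega⟩, rfl⟩
    · rw [h]
      subst hm
      have : (m + 2) * c = m * c + c + c := by ring
      exact Submodule.subset_span ⟨Sum.inr ⟨s, by omega⟩, rfl⟩

/-- The evaluation map to dual numbers over `k[x]`. -/
def ribEval (k : Type*) [Field k] (g : ℕ) :
    RibAlg k g →ₐ[k] DualNumber (Polynomial k) :=
  Ideal.Quotient.liftₐ (Ideal.span (ribRels k g))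
    (aeval (Sum.elim (fun i => TrivSqZeroExt.inl (Polynomial.X ^ (i : ℕ)))
      (fun j => TrivSqZeroExt.inr (Polynomial.X ^ (j : ℕ)))))
    (by
      intro a ha
      rw [← RingHom.mem_ker]
      revert a
      change Ideal.span (ribRels k g) ≤ _
      rw [Ideal.span_le]
      rintro f ((⟨i, j, l, m, h, rfl⟩ | ⟨i, l, j, m, h, rfl⟩) | ⟨j, m, rfl⟩)
      · simp [RingHom.mem_ker, ← TrivSqZeroExt.inl_mul, ← pow_add, h]
      · simp only [SetLike.mem_coe, RingHom.mem_ker, map_sub, map_mul]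
        erw [aeval_X, aeval_X, aeval_X, aeval_X]
        simp only [Sum.elim_inl, Sum.elim_inr, TrivSqZeroExt.inl_mul_inr, smul_eq_mul, ← pow_add,
          h, sub_self]
      · simp [RingHom.mem_ker])

theorem ribEval_uA (k : Type*) [Field k] (c i : ℕ) (hi : i ≤ c) :
    ribEval k (c + 1) (uA k c i) = TrivSqZeroExt.inl (Polynomial.X ^ i) := by
  unfold uA
  rw [dif_pos (by omega)]
  exact (aeval_X _ _)

theorem ribEval_vA (k : Type*) [Field k] (c i : ℕ) (hi : i + 2 ≤ c) :
    ribEval k (c + 1) (vA k c i) = TrivSqZeroExt.inr (Polynomial.X ^ i) := by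
  unfold vA
  rw [dif_pos (by omega)]
  exact (aeval_X _ _)

theorem ribEval_canU (k : Type*) [Field k] (c n : ℕ) : ∀ s ≤ n * c,
    ribEval k (c + 1) (canU (uA k c) c n s) = TrivSqZeroExt.inl (Polynomial.X ^ s) := by
  induction n with
  | zero => intro s hs; have : s = 0 := by simpa using hs
            subst this; simp [canU]
  | succ n ih =>
    intro s hs
    rw [add_mul, one_mul] at hs
    rw [canU, map_mul, ribEval_uA _ _ _ (by omega), ih _ (by omega), ← TrivSqZeroExt.inl_mul,
      ← pow_add]
    congr 2
    omega

theorem ribEval_canV (k : Type*) [Field k] (c n s : ℕ) (hc : 2 ≤ c) (hs : s + 2 ≤ n * c + c) :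
    ribEval k (c + 1) (canV (uA k c) (vA k c) c n s)
      = TrivSqZeroExt.inr (Polynomial.X ^ s) := by
  rw [canV, map_mul, ribEval_vA _ _ _ (by omega), ribEval_canU _ _ _ _ (by omega),
    TrivSqZeroExt.inr_mul_inl, op_smul_eq_smul, smul_eq_mul, ← pow_add]
  congr 2
  omega

theorem linInd_ribFam (k : Type*) [Field k] (c n : ℕ) (hc : 2 ≤ c) :
    LinearIndependent k (ribFam k c n) := by
  let L : DualNumber (Polynomial k) →ₗ[k] Polynomial k × Polynomial k :=
    { toFun := fun x => (x.fst, x.snd)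
      map_add' := fun _ _ => rfl
      map_smul' := fun _ _ => rfl }
  have hL1 : ∀ p : Polynomial k, L (TrivSqZeroExt.inl p) = (p, 0) := fun _ => rfl
  have hL2 : ∀ p : Polynomial k, L (TrivSqZeroExt.inr p) = (0, p) := fun _ => rfl
  apply LinearIndependent.of_comp (L ∘ₗ (ribEval k (c + 1)).toLinearMap)
  let B := (Polynomial.basisMonomials k).prod (Polynomial.basisMonomials k)
  have hB : LinearIndependent k (B ∘ (Sum.map Fin.val Fin.val :
      Fin (n * c + 1) ⊕ Fin (n * c - (c + 1)) → ℕ ⊕ ℕ)) :=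
    B.linearIndependent.comp _ (Sum.map_injective.2 ⟨Fin.val_injective, Fin.val_injective⟩)
  convert hB using 1
  funext s
  rcases s with s | s
  · have := ribEval_canU k c n s (by omega)
    rw [Polynomial.X_pow_eq_monomial] at this
    have h2 := congrArg L this
    refine h2.trans ?_
    rw [hL1]
    ext1 <;> simp [B]
  · have hs := s.2
    have hn : 2 ≤ n := by
      by_contra h
      have : n = 0 ∨ n = 1 := by omega
      rcases this with h | h <;> subst h <;> simp at hs
    obtain ⟨m, rfl⟩ := Nat.exists_eq_add_of_le' hn
    have h1 : (m + 2) * c = m * c + c + c := by ring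
    have := ribEval_canV k c m s hc (by omega)
    rw [Polynomial.X_pow_eq_monomial] at this
    have h2 := congrArg L this
    refine h2.trans ?_
    rw [hL2]
    ext1 <;> simp [B]

theorem finrank_piece (k : Type*) [Field k] (c n : ℕ) (hc : 2 ≤ c) :
    Module.finrank k (gradedPiece k (c + 1) n) = (n * c + 1) + (n * c - (c + 1)) := by
  rw [← span_ribFam k c n hc, finrank_span_eq_card (linInd_ribFam k c n hc)]
  simp

/-- the Hilbert series of the homogeneous coordinate ring of the
hyperelliptic ribbon: `dim A₀ = 1`, `dim A₁ = g`, and for `n ≥ 2`,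
`dim Aₙ = (n(g-1)+1) + (n(g-1)-g)`. -/
theorem ribbon_hilbert_series (k : Type*) [Field k] (g : ℕ) (hg : 3 ≤ g) :
    Module.finrank k (gradedPiece k g 0) = 1 ∧
    Module.finrank k (gradedPiece k g 1) = g ∧
    ∀ n : ℕ, 2 ≤ n →
      Module.finrank k (gradedPiece k g n) = (n * (g - 1) + 1) + (n * (g - 1) - g) := by
  obtain ⟨c, rfl⟩ : ∃ c, g = c + 1 := ⟨g - 1, by omega⟩
  have hc : 2 ≤ c := by omega
  refine ⟨?_, ?_, fun n _ => ?_⟩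
  · rw [finrank_piece k c 0 hc]; simp
  · rw [finrank_piece k c 1 hc]; simp
  · rw [finrank_piece k c n hc]; simp
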